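/- Let a ∈ ℝ³ and let G(t,x) = (4πt)^{−3/2} exp(−|x|²/(4t)). For t > 0 define K(t) = −(√(2π)/(16π²)) Σ_{2l+|β|=3} (∂_t^l ∇^β (a·∇)G(t)/β!) ∫_{ℝ³} (−1)^l (−y)^β G(1,y) ( 2 a·∇G(1/2, y) + ∫₀¹ s^{−1/2} Δ(a·∇)G(1 − s/2, y) ds ) dy, where the sum is over integers l ≥ 0 and multi-indices β with 2l + |β| = 3. Then K(t) = −(√3/(2⁶·3³·5 π³)) Δ(a·∇)² G(t) for all t > 0, where (a·∇)² denotes the second directional derivative in direction a. -/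

import Mathlib

open MeasureTheory Real Filter
open scoped ENNReal NNReal

/-- The `n`-dimensional Gaussian heat kernel `G(t,x) = (4πt)^{-n/2} exp(-|x|²/(4t))`. -/
noncomputable def heatG (n : ℕ) (t : ℝ) (x : EuclideanSpace ℝ (Fin n)) : ℝ :=
  (4 * π * t) ^ (-(n : ℝ) / 2) * Real.exp (-‖x‖ ^ 2 / (4 * t))

/-- Directional derivative `a·∇f`. -/
noncomputable def dirD {n : ℕ} (a : EuclideanSpace ℝ (Fin n))
    (f : EuclideanSpace ℝ (Fin n) → ℝ) (x : EuclideanSpace ℝ (Fin n)) : ℝ :=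
  fderiv ℝ f x a

/-- Partial derivative `∂_j f`. -/
noncomputable def pd {n : ℕ} (j : Fin n) (f : EuclideanSpace ℝ (Fin n) → ℝ)
    (x : EuclideanSpace ℝ (Fin n)) : ℝ :=
  fderiv ℝ f x (EuclideanSpace.single j 1)

/-- Spatial Laplacian `Δf = Σ_j ∂_j² f`. -/
noncomputable def lap {n : ℕ} (f : EuclideanSpace ℝ (Fin n) → ℝ)
    (x : EuclideanSpace ℝ (Fin n)) : ℝ :=
  ∑ j : Fin n, pd j (fun z => pd j f z) x

/-- Multi-index spatial derivative `∇^α f = ∂_1^{α_1} ⋯ ∂_n^{α_n} f`. -/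
noncomputable def mD {n : ℕ} (α : Fin n → ℕ) (f : EuclideanSpace ℝ (Fin n) → ℝ) :
    EuclideanSpace ℝ (Fin n) → ℝ :=
  (List.finRange n).foldr (fun j g => (pd j)^[α j] g) f

/-- Iterated time derivative `∂_t^l F`. -/
noncomputable def tD {n : ℕ} (l : ℕ) (F : ℝ → EuclideanSpace ℝ (Fin n) → ℝ) :
    ℝ → EuclideanSpace ℝ (Fin n) → ℝ :=
  (fun H => fun t x => deriv (fun τ => H τ x) t)^[l] F

/-- `u` is a mild solution of `∂_t u - Δu = a·∇(u²)` with initial data `u₀`: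
the Duhamel formula `u(t) = G(t)*u₀ + ∫₀ᵗ a·∇G(t-s) * u(s)² ds` holds. -/
def IsMildSolution {n : ℕ} (a : EuclideanSpace ℝ (Fin n))
    (u₀ : EuclideanSpace ℝ (Fin n) → ℝ) (u : ℝ → EuclideanSpace ℝ (Fin n) → ℝ) : Prop :=
  ∀ t : ℝ, 0 < t → ∀ x, u t x = (∫ y, heatG n t (x - y) * u₀ y) +
    ∫ s in Set.Ioo (0:ℝ) t, ∫ y, dirD a (heatG n (t - s)) (x - y) * (u s y) ^ 2

/-- The decay exponent `γ_q = (n/2)(1 - 1/q)` (with `1/∞ = 0`). -/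
noncomputable def gam (n : ℕ) (q : ℝ≥0∞) : ℝ := (n : ℝ) / 2 * (1 - 1 / q.toReal)

/-- The decay estimate `‖u(t)‖_{L^q} ≤ C(1+t)^{-γ_q}` for all `1 ≤ q ≤ ∞` and `t > 0`. -/
def SatisfiesDecay {n : ℕ} (u : ℝ → EuclideanSpace ℝ (Fin n) → ℝ) : Prop :=
  ∀ q : ℝ≥0∞, 1 ≤ q → ∃ C : ℝ, 0 < C ∧ ∀ t : ℝ, 0 < t →
    eLpNorm (u t) q volume ≤ ENNReal.ofReal (C * (1 + t) ^ (-(gam n q)))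


open MvPolynomial

/-- The operator on polynomials conjugate to `∂_j` under multiplication by the heat kernel. -/
noncomputable def heatOp (t : ℝ) (j : Fin 3) :
    MvPolynomial (Fin 3) ℝ →ₗ[ℝ] MvPolynomial (Fin 3) ℝ :=
  (pderiv j).toLinearMap - LinearMap.mulLeft ℝ (C (1 / (2 * t)) * X j)

theorem heatOp_apply (t : ℝ) (j : Fin 3) (P : MvPolynomial (Fin 3) ℝ) :
    heatOp t j P = pderiv j P - C (1 / (2 * t)) * X j * P := by
  simp [heatOp, mul_assoc]

theorem heatOp_comm (t : ℝ) (i j : Fin 3) (P : MvPolynomial (Fin 3) ℝ) :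
    heatOp t i (heatOp t j P) = heatOp t j (heatOp t i P) := by
  have h : pderiv i (pderiv j P) = pderiv j (pderiv i P) := by
    have h0 : ⁅pderiv i, pderiv j⁆ = (0 : Derivation ℝ (MvPolynomial (Fin 3) ℝ) _) :=
      derivation_ext fun k => by
        rw [Derivation.commutator_apply]
        simp [pderiv_X, Pi.single_apply, apply_ite]
    exact sub_eq_zero.1 (by rw [← Derivation.commutator_apply, h0]; rfl)
  simp only [heatOp_apply, map_sub, Derivation.leibniz, pderiv_C, smul_eq_mul, h]
  rcases eq_or_ne i j with rfl | hij
  · ring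
  · simp only [pderiv_X_of_ne hij, pderiv_X_of_ne hij.symm]; ring

theorem heatOp_C_mul (t : ℝ) (i : Fin 3) (c : ℝ) (P : MvPolynomial (Fin 3) ℝ) :
    heatOp t i (C c * P) = C c * heatOp t i P := by
  rw [← smul_eq_C_mul, map_smul, smul_eq_C_mul]

/-- The polynomial `P` with `a·∇(Q G) = P G`. -/
noncomputable def heatDir (t : ℝ) (a : EuclideanSpace ℝ (Fin 3)) (Q : MvPolynomial (Fin 3) ℝ) :
    MvPolynomial (Fin 3) ℝ := ∑ j, C (a j) * heatOp t j Q

theorem hasFDerivAt_eval (P : MvPolynomial (Fin 3) ℝ) (x : EuclideanSpace ℝ (Fin 3)) :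
    HasFDerivAt (fun y : EuclideanSpace ℝ (Fin 3) => eval y.ofLp P)
      (∑ j, eval x.ofLp (pderiv j P) •
        (EuclideanSpace.proj j : EuclideanSpace ℝ (Fin 3) →L[ℝ] ℝ)) x := by
  induction P using MvPolynomial.induction_on with
  | C c => simpa using hasFDerivAt_const c x
  | add p q hp hq =>
    simp only [map_add, add_smul, Finset.sum_add_distrib]
    exact hp.add hq
  | mul_X p i hp =>
    have h := hp.mul (EuclideanSpace.proj i : EuclideanSpace ℝ (Fin 3) →L[ℝ] ℝ).hasFDerivAt (x := x)
    refine (h.congr_fderiv ?_).congr_of_eventuallyEq (.of_forall fun y => by simp)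
    ext v
    simp [Derivation.leibniz, pderiv_X, Pi.single_apply, add_mul,
      Finset.sum_add_distrib, Finset.mul_sum, mul_assoc, apply_ite, Finset.sum_ite_eq]

theorem hasFDerivAt_exp_neg_mul_sq (b : ℝ) (x : EuclideanSpace ℝ (Fin 3)) :
    HasFDerivAt (fun y : EuclideanSpace ℝ (Fin 3) => rexp (-b * ‖y‖ ^ 2))
      (rexp (-b * ‖x‖ ^ 2) • (-b) • (2 • innerSL ℝ x)) x :=
  ((hasStrictFDerivAt_norm_sq x).hasFDerivAt.const_mul (-b)).exp

theorem heatG_eq (t : ℝ) (x : EuclideanSpace ℝ (Fin 3)) :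
    heatG 3 t x = (4 * π * t) ^ (-(3 : ℝ) / 2) * rexp (-(1 / (4 * t)) * ‖x‖ ^ 2) := by
  unfold heatG; push_cast; congr 2; ring

theorem dirD_eval_mul_heatG (t : ℝ) (a : EuclideanSpace ℝ (Fin 3)) (P : MvPolynomial (Fin 3) ℝ) :
    dirD a (fun x => eval x.ofLp P * heatG 3 t x) =
      fun x => eval x.ofLp (heatDir t a P) * heatG 3 t x := by
  ext x
  have h := (hasFDerivAt_eval P x).mul
    ((hasFDerivAt_exp_neg_mul_sq (1 / (4 * t)) x).const_mul ((4 * π * t) ^ (-(3 : ℝ) / 2)))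
  simp only [heatG_eq, dirD]
  erw [h.fderiv]
  simp [heatDir, heatOp_apply, PiLp.inner_apply, Fin.sum_univ_three]
  ring

theorem dirD_heatG (t : ℝ) (a : EuclideanSpace ℝ (Fin 3)) :
    dirD a (heatG 3 t) = fun x => eval x.ofLp (heatDir t a 1) * heatG 3 t x := by
  rw [← dirD_eval_mul_heatG]; simp

theorem pd_eval_mul_heatG (t : ℝ) (j : Fin 3) (P : MvPolynomial (Fin 3) ℝ) :
    pd j (fun x => eval x.ofLp P * heatG 3 t x) =
      fun x => eval x.ofLp (heatOp t j P) * heatG 3 t x := by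
  have h := dirD_eval_mul_heatG t (EuclideanSpace.single j 1) P
  have h2 : heatDir t (EuclideanSpace.single j 1) P = heatOp t j P := by
    simp [heatDir, apply_ite, ite_mul]
  rw [h2] at h
  exact h

theorem iterate_pd_eval_mul_heatG (t : ℝ) (j : Fin 3) (m : ℕ) (P : MvPolynomial (Fin 3) ℝ) :
    (pd j)^[m] (fun x => eval x.ofLp P * heatG 3 t x) =
      fun x => eval x.ofLp ((heatOp t j)^[m] P) * heatG 3 t x := by
  induction m generalizing P with
  | zero => rfl
  | succ m ih => rw [Function.iterate_succ_apply, pd_eval_mul_heatG, ih]; rfl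

theorem mD_eval_mul_heatG (t : ℝ) (α : Fin 3 → ℕ) (P : MvPolynomial (Fin 3) ℝ) :
    mD α (fun x => eval x.ofLp P * heatG 3 t x) =
      fun x => eval x.ofLp ((heatOp t 0)^[α 0] ((heatOp t 1)^[α 1] ((heatOp t 2)^[α 2] P))) *
        heatG 3 t x := by
  simp [mD, List.finRange_succ, iterate_pd_eval_mul_heatG]

theorem lap_eval_mul_heatG (t : ℝ) (P : MvPolynomial (Fin 3) ℝ) :
    lap (fun x => eval x.ofLp P * heatG 3 t x) =
      fun x => eval x.ofLp (∑ j, heatOp t j (heatOp t j P)) * heatG 3 t x := by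
  ext x
  simp only [lap, pd_eval_mul_heatG, map_sum, Finset.sum_mul]

theorem hasDerivAt_heatG {t : ℝ} (ht : 0 < t) (x : EuclideanSpace ℝ (Fin 3)) :
    HasDerivAt (fun τ => heatG 3 τ x) ((‖x‖ ^ 2 / (4 * t ^ 2) - 3 / (2 * t)) * heatG 3 t x) t := by
  have h4 : 0 < 4 * π * t := by positivity
  have h1 : HasDerivAt (fun τ : ℝ => 4 * π * τ) (4 * π) t := by
    simpa using (hasDerivAt_id t).const_mul (4 * π)
  have h2 := h1.rpow_const (p := -(3 : ℝ) / 2) (Or.inl h4.ne')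
  have h3 : HasDerivAt (fun τ : ℝ => -‖x‖ ^ 2 / (4 * τ)) (‖x‖ ^ 2 / (4 * t ^ 2)) t := by
    have := (hasDerivAt_const t (-‖x‖ ^ 2)).div ((hasDerivAt_id t).const_mul 4) (by simp [ht.ne'])
    refine this.congr_deriv ?_
    simp
    field_simp
  refine (h2.mul h3.exp).congr_deriv ?_
  rw [rpow_sub_one h4.ne']
  simp only [heatG]
  push_cast
  field_simp
  ring

theorem norm_sq_eq (x : EuclideanSpace ℝ (Fin 3)) : ‖x‖ ^ 2 = x 0 ^ 2 + x 1 ^ 2 + x 2 ^ 2 := by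
  simp [EuclideanSpace.norm_sq_eq, Fin.sum_univ_three]

theorem deriv_pd_dirD_heatG {t : ℝ} (ht : 0 < t) (a : EuclideanSpace ℝ (Fin 3)) (k : Fin 3)
    (x : EuclideanSpace ℝ (Fin 3)) :
    deriv (fun τ => eval x.ofLp (heatOp τ k (heatDir τ a 1)) * heatG 3 τ x) t =
      eval x.ofLp (heatOp t k (∑ j, heatOp t j (heatOp t j (heatDir t a 1)))) * heatG 3 t x := by
  have e : ∀ τ : ℝ, eval x.ofLp (heatOp τ k (heatDir τ a 1)) =
      x k * (∑ j, a j * x j) * ((2 * τ)⁻¹) ^ 2 - a k * (2 * τ)⁻¹ := by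
    intro τ
    fin_cases k <;>
    simp [heatDir, heatOp_apply, Fin.sum_univ_three, Derivation.leibniz, pderiv_X] <;> ring
  have hi : HasDerivAt (fun τ : ℝ => (2 * τ)⁻¹) (-2 / (2 * t) ^ 2) t := by
    have : HasDerivAt (fun τ : ℝ => 2 * τ) 2 t := by simpa using (hasDerivAt_id t).const_mul 2
    exact this.inv (by positivity)
  have h := ((((hi.pow 2).const_mul (x k * (∑ j, a j * x j))).sub (hi.const_mul (a k))).mul
    (hasDerivAt_heatG ht x))
  simp only [e]
  have key : (x k * ∑ j, a j * x j) * (2 * (2 * t)⁻¹ * (-2 / (2 * t) ^ 2)) -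
      a k * (-2 / (2 * t) ^ 2) + ((x k * ∑ j, a j * x j) * ((2 * t)⁻¹) ^ 2 - a k * (2 * t)⁻¹) *
        (‖x‖ ^ 2 / (4 * t ^ 2) - 3 / (2 * t)) =
      eval x.ofLp (heatOp t k (∑ j, heatOp t j (heatOp t j (heatDir t a 1)))) := by
    rw [norm_sq_eq]
    fin_cases k <;>
      simp [heatDir, heatOp_apply, Fin.sum_univ_three, Derivation.leibniz, pderiv_X,
        Pi.single_apply] <;>
      field_simp <;> ring
  refine h.deriv.trans ?_
  rw [← key]
  simp
  ring

theorem continuous_eval_ofLp (P : MvPolynomial (Fin 3) ℝ) :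
    Continuous fun y : EuclideanSpace ℝ (Fin 3) => eval y.ofLp P :=
  (continuous_eval P).comp (PiLp.continuous_ofLp 2 _)

theorem integrable_eval_mul_exp {b : ℝ} (hb : 0 < b) (P : MvPolynomial (Fin 3) ℝ) :
    Integrable fun y : EuclideanSpace ℝ (Fin 3) => eval y.ofLp P * rexp (-b * ‖y‖ ^ 2) := by
  induction P using MvPolynomial.induction_on' with
  | monomial u c =>
    have h1 : ∀ n : ℕ, Integrable fun x : ℝ => x ^ n * rexp (-b * x ^ 2) := fun n => by
      simpa using integrable_rpow_mul_exp_neg_mul_sq hb (s := n)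
        (by linarith [n.cast_nonneg (α := ℝ)])
    have h2 := Integrable.fintype_prod (f := fun (i : Fin 3) (x : ℝ) => x ^ u i * rexp (-b * x ^ 2))
      (fun i => h1 (u i))
    have h3 := ((PiLp.volume_preserving_ofLp (Fin 3)).integrable_comp
      h2.aestronglyMeasurable).2 h2
    refine (h3.const_mul c).congr (.of_forall fun y => ?_)
    simp only [Function.comp_apply, eval_monomial, Finset.prod_mul_distrib, ← Real.exp_sum,
      ← Finset.mul_sum, EuclideanSpace.norm_sq_eq, Finsupp.prod_fintype, pow_zero,
      Real.norm_eq_abs, sq_abs, implies_true, mul_assoc]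
  | add p q hp hq =>
    simp only [map_add, add_mul]
    exact hp.add hq

/-- Integration of a polynomial against `exp (-b|y|²)`. -/
noncomputable def gaussInt (b : ℝ) (P : MvPolynomial (Fin 3) ℝ) : ℝ :=
  ∫ y : EuclideanSpace ℝ (Fin 3), eval y.ofLp P * rexp (-b * ‖y‖ ^ 2)

theorem gaussInt_add {b : ℝ} (hb : 0 < b) (P Q : MvPolynomial (Fin 3) ℝ) :
    gaussInt b (P + Q) = gaussInt b P + gaussInt b Q := by
  unfold gaussInt
  rw [← integral_add (integrable_eval_mul_exp hb P) (integrable_eval_mul_exp hb Q)]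
  simp only [map_add, add_mul]

theorem gaussInt_C_mul (b c : ℝ) (P : MvPolynomial (Fin 3) ℝ) :
    gaussInt b (C c * P) = c * gaussInt b P := by
  unfold gaussInt
  rw [← integral_const_mul]
  simp only [map_mul, eval_C, mul_assoc]

theorem gaussInt_zero (b : ℝ) : gaussInt b 0 = 0 := by
  simp [gaussInt]

theorem gaussInt_sum {b : ℝ} (hb : 0 < b) {ι : Type*} (s : Finset ι)
    (P : ι → MvPolynomial (Fin 3) ℝ) :
    gaussInt b (∑ i ∈ s, P i) = ∑ i ∈ s, gaussInt b (P i) := by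
  classical
  induction s using Finset.induction_on with
  | empty => simp [gaussInt_zero]
  | insert i s hi ih => rw [Finset.sum_insert hi, Finset.sum_insert hi, gaussInt_add hb, ih]

theorem gaussInt_one {b : ℝ} (hb : 0 < b) : gaussInt b 1 = (π / b) ^ (3 / 2 : ℝ) := by
  have := GaussianFourier.integral_rexp_neg_mul_sq_norm (V := EuclideanSpace ℝ (Fin 3)) hb
  simpa [gaussInt] using this

theorem gaussInt_X_mul {b : ℝ} (hb : 0 < b) (j : Fin 3) (P : MvPolynomial (Fin 3) ℝ) :
    gaussInt b (X j * P) = 1 / (2 * b) * gaussInt b (pderiv j P) := by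
  have hP : ∀ x : EuclideanSpace ℝ (Fin 3), fderiv ℝ (fun y : EuclideanSpace ℝ (Fin 3) =>
      eval y.ofLp P) x (EuclideanSpace.single j 1) = eval x.ofLp (pderiv j P) := fun x => by
    rw [(hasFDerivAt_eval P x).fderiv]
    simp
  have hE : ∀ x : EuclideanSpace ℝ (Fin 3), fderiv ℝ (fun y : EuclideanSpace ℝ (Fin 3) =>
      rexp (-b * ‖y‖ ^ 2)) x (EuclideanSpace.single j 1) =
        -(2 * b) * (x j * rexp (-b * ‖x‖ ^ 2)) := fun x => by
    rw [(hasFDerivAt_exp_neg_mul_sq b x).fderiv]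
    simp [EuclideanSpace.inner_single_right]
    ring
  have h := integral_mul_fderiv_eq_neg_fderiv_mul_of_integrable (μ := volume)
    (f := fun y : EuclideanSpace ℝ (Fin 3) => eval y.ofLp P)
    (g := fun y : EuclideanSpace ℝ (Fin 3) => rexp (-b * ‖y‖ ^ 2))
    (v := EuclideanSpace.single j 1)
    (by simpa only [hP] using integrable_eval_mul_exp hb _)
    (by
      simp only [hE]
      refine ((integrable_eval_mul_exp hb (X j * P)).const_mul (-(2 * b))).congr
        (.of_forall fun y => ?_)
      simp; ring)
    (integrable_eval_mul_exp hb P)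
    (fun x _ => (hasFDerivAt_eval P x).differentiableAt)
    (fun x _ => (hasFDerivAt_exp_neg_mul_sq b x).differentiableAt)
  simp only [hP, hE] at h
  have h2 : ∫ y : EuclideanSpace ℝ (Fin 3), eval y.ofLp P *
      (-(2 * b) * (y j * rexp (-b * ‖y‖ ^ 2))) =
      -(2 * b) * gaussInt b (X j * P) := by
    rw [gaussInt, ← integral_const_mul]
    congr 1; ext y; simp; ring
  rw [h2] at h
  change _ = - gaussInt b (pderiv j P) at h
  field_simp
  linarith

/-- `|y|²` as a polynomial. -/
noncomputable def normSqPoly : MvPolynomial (Fin 3) ℝ := ∑ j, X j * X j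

theorem gaussInt_normSqPoly_mul {b : ℝ} (hb : 0 < b) {P : MvPolynomial (Fin 3) ℝ} {n : ℕ}
    (hP : P.IsHomogeneous n) :
    gaussInt b (normSqPoly * P) = (n + 3) / (2 * b) * gaussInt b P := by
  have h : normSqPoly * P = ∑ j, X j * (X j * P) := by
    simp only [normSqPoly, Finset.sum_mul, mul_assoc]
  have h2 : ∑ j, pderiv j (X j * P) = C ((n : ℝ) + 3) * P := by
    have := hP.sum_X_mul_pderiv
    simp only [Derivation.leibniz, smul_eq_mul, pderiv_X_self, Finset.sum_add_distrib, this]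
    rw [C_add, show (C (3 : ℝ) : MvPolynomial (Fin 3) ℝ) = 3 from map_ofNat C 3]
    simp
    ring
  rw [h, gaussInt_sum hb]
  simp only [gaussInt_X_mul hb]
  rw [← Finset.mul_sum, ← gaussInt_sum hb, h2, gaussInt_C_mul]
  ring

/-- The polynomial `a·y`. -/
noncomputable def linPoly (a : EuclideanSpace ℝ (Fin 3)) : MvPolynomial (Fin 3) ℝ :=
  ∑ j, C (a j) * X j

theorem integrable_prod_eval_mul_exp {k b : ℝ → ℝ} {S : Set ℝ} (hS : MeasurableSet S)
    (hk : IntegrableOn k S) (hb : Measurable b) {c : ℝ} (hc : 0 < c) (hcb : ∀ s ∈ S, c ≤ b s)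
    (P : MvPolynomial (Fin 3) ℝ) :
    Integrable (fun z : EuclideanSpace ℝ (Fin 3) × ℝ =>
      k z.2 * (eval z.1.ofLp P * rexp (-b z.2 * ‖z.1‖ ^ 2))) (volume.prod (volume.restrict S)) := by
  have h := (integrable_eval_mul_exp hc P).mul_prod hk
  refine h.mono ?_ ?_
  · refine (hk.aestronglyMeasurable.comp_snd).mul (Measurable.aestronglyMeasurable ?_)
    have h1 := (continuous_eval_ofLp P).measurable.comp
      (measurable_fst : Measurable (Prod.fst : EuclideanSpace ℝ (Fin 3) × ℝ → _))
    exact h1.mul (by fun_prop)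
  · have hmem : ∀ᵐ z ∂(volume : Measure (EuclideanSpace ℝ (Fin 3))).prod (volume.restrict S),
        z.2 ∈ S := by
      exact Measure.quasiMeasurePreserving_snd.ae (ae_restrict_mem hS)
    filter_upwards [hmem] with z hz
    rw [mul_comm (k z.2), norm_mul, norm_mul, norm_mul, norm_mul, Real.norm_eq_abs (rexp _),
      Real.norm_eq_abs (rexp _), abs_exp, abs_exp]
    gcongr
    exact hcb _ hz

theorem intervalIntegrable_rpow_mul {g : ℝ → ℝ} (hg : ContinuousOn g (Set.Icc 0 1)) :
    IntegrableOn (fun s => s ^ (-(1 : ℝ) / 2) * g s) (Set.Ioo 0 1) := by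
  have h := (intervalIntegral.intervalIntegrable_rpow' (a := 0) (b := 1)
    (r := -(1 : ℝ) / 2) (by norm_num)).mul_continuousOn (g := g) (by simpa using hg)
  exact ((intervalIntegrable_iff_integrableOn_Ioc_of_le zero_le_one).1 h).mono_set
    Set.Ioo_subset_Ioc_self

theorem isHomogeneous_linPoly (a : EuclideanSpace ℝ (Fin 3)) : (linPoly a).IsHomogeneous 1 := by
  refine IsHomogeneous.sum _ _ _ fun j _ => ?_
  simpa using (isHomogeneous_C (Fin 3) (a j)).mul (isHomogeneous_X ℝ j)

theorem pderiv_linPoly (a : EuclideanSpace ℝ (Fin 3)) (i : Fin 3) :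
    pderiv i (linPoly a) = C (a i) := by
  simp [linPoly, pderiv_X, Pi.single_apply]

theorem gaussInt_X_mul_linPoly {b : ℝ} (hb : 0 < b) (a : EuclideanSpace ℝ (Fin 3)) (i : Fin 3) :
    gaussInt b (X i * linPoly a) = a i * (1 / (2 * b)) ^ 1 * (π / b) ^ (3 / 2 : ℝ) := by
  rw [gaussInt_X_mul hb, pderiv_linPoly, ← mul_one (C (a i)), gaussInt_C_mul, gaussInt_one hb]
  ring

theorem gaussInt_X_mul_X_mul_X_mul_linPoly {b : ℝ} (hb : 0 < b) (a : EuclideanSpace ℝ (Fin 3))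
    (i j k : Fin 3) :
    gaussInt b (X i * X j * X k * linPoly a) =
      ((if i = j then a k else 0) + (if i = k then a j else 0) + (if j = k then a i else 0)) *
        (1 / (2 * b)) ^ 2 * (π / b) ^ (3 / 2 : ℝ) := by
  have h : ∀ l m : Fin 3, pderiv l (X m : MvPolynomial (Fin 3) ℝ) = C (if l = m then 1 else 0) := by
    intro l m
    simp [pderiv_X, Pi.single_apply, apply_ite, eq_comm]
  have e : pderiv i (X j * (X k * linPoly a)) = C (if i = j then 1 else 0) * (X k * linPoly a) +
      (C (if i = k then 1 else 0) * (X j * linPoly a) + C (a i) * (X j * (X k * 1))) := by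
    simp only [Derivation.leibniz, smul_eq_mul, h, pderiv_linPoly]
    ring
  rw [show X i * X j * X k * linPoly a = X i * (X j * (X k * linPoly a)) by ring,
    gaussInt_X_mul hb, e, gaussInt_add hb, gaussInt_add hb]
  simp only [gaussInt_C_mul, gaussInt_X_mul_linPoly hb]
  rw [gaussInt_X_mul hb j, mul_one, h, ← mul_one (C _), gaussInt_C_mul, gaussInt_one hb]
  split_ifs <;> ring

theorem eval_heatDir_one (t : ℝ) (a y : EuclideanSpace ℝ (Fin 3)) :
    eval y.ofLp (heatDir t a 1) = -(1 / (2 * t)) * eval y.ofLp (linPoly a) := by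
  simp [heatDir, heatOp_apply, linPoly, Fin.sum_univ_three]
  ring

theorem eval_sum_heatOp_heatDir_one {t : ℝ} (ht : t ≠ 0) (a y : EuclideanSpace ℝ (Fin 3)) :
    eval y.ofLp (∑ j, heatOp t j (heatOp t j (heatDir t a 1))) =
      -(1 / (8 * t ^ 3)) * eval y.ofLp (normSqPoly * linPoly a) +
        5 / (4 * t ^ 2) * eval y.ofLp (linPoly a) := by
  simp [heatDir, heatOp_apply, linPoly, normSqPoly, Fin.sum_univ_three, Derivation.leibniz,
    pderiv_X, Pi.single_apply]
  field_simp
  ring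

theorem heatG_one_mul_heatG {t : ℝ} (ht : 0 < t) (y : EuclideanSpace ℝ (Fin 3)) :
    heatG 3 1 y * heatG 3 t y = (4 * π) ^ (-(3 : ℝ) / 2) * ((4 * π) ^ (-(3 : ℝ) / 2) *
      t ^ (-(3 : ℝ) / 2)) * rexp (-(1 / 4 + 1 / (4 * t)) * ‖y‖ ^ 2) := by
  rw [heatG_eq, heatG_eq, mul_rpow (by positivity) ht.le, mul_one,
    show -(1 / 4 + 1 / (4 * t)) * ‖y‖ ^ 2 = -(1 / (4 * 1)) * ‖y‖ ^ 2 + -(1 / (4 * t)) * ‖y‖ ^ 2 by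
      ring, Real.exp_add]
  ring

theorem heat_const_mul {t : ℝ} (ht : 0 < t) :
    (4 * π) ^ (-(3 : ℝ) / 2) * t ^ (-(3 : ℝ) / 2) * (π / (1 / 4 + 1 / (4 * t))) ^ (3 / 2 : ℝ) =
      (1 / (1 + t)) ^ (3 / 2 : ℝ) := by
  have h : π / (1 / 4 + 1 / (4 * t)) = 4 * π * t * (1 / (1 + t)) := by
    field_simp
    ring
  rw [h, mul_rpow (x := 4 * π * t) (by positivity) (by positivity),
    ← mul_rpow (x := 4 * π) (by positivity) ht.le,
    ← mul_assoc, ← rpow_add (by positivity)]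
  norm_num

/-- The time integrand obtained by integrating out the space variable. -/
noncomputable def momentWeight (q : ℕ) (t : ℝ) : ℝ :=
  (1 / (1 + t)) ^ (3 / 2 : ℝ) * ((2 * t / (1 + t)) ^ q *
    (-(1 / (8 * t ^ 3)) * ((2 * q + 3) * (2 * t / (1 + t))) + 5 / (4 * t ^ 2)))

theorem integral_eval_mul_kernel (a : EuclideanSpace ℝ (Fin 3)) {P : MvPolynomial (Fin 3) ℝ}
    {d q : ℕ} (hP : P.IsHomogeneous d) (hd : d + 1 = 2 * q) {μ : ℝ}
    (hμ : ∀ b : ℝ, 0 < b →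
      gaussInt b (P * linPoly a) = μ * (1 / (2 * b)) ^ q * (π / b) ^ (3 / 2 : ℝ)) :
    ∫ y : EuclideanSpace ℝ (Fin 3), eval y.ofLp P * heatG 3 1 y *
        (2 * dirD a (heatG 3 (1 / 2)) y + ∫ s in Set.Ioo (0 : ℝ) 1, s ^ (-(1 : ℝ) / 2) *
          lap (dirD a (heatG 3 (1 - s / 2))) y) =
      μ * (4 * π) ^ (-(3 : ℝ) / 2) * (-2 * (2 / 3) ^ q * (2 / 3) ^ (3 / 2 : ℝ) +
        ∫ s in Set.Ioo (0 : ℝ) 1, s ^ (-(1 : ℝ) / 2) * momentWeight q (1 - s / 2)) := by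
  set A : ℝ := (4 * π) ^ (-(3 : ℝ) / 2) with hA
  set Q := P * linPoly a with hQ
  have hQh : Q.IsHomogeneous (d + 1) := hP.mul (isHomogeneous_linPoly a)
  set b : ℝ → ℝ := fun s => 1 / 4 + 1 / (4 * (1 - s / 2)) with hb
  set w : ℝ → ℝ := fun s => A * (A * (1 - s / 2) ^ (-(3 : ℝ) / 2)) with hw
  set k₁ : ℝ → ℝ := fun s => s ^ (-(1 : ℝ) / 2) * (w s * (5 / (4 * (1 - s / 2) ^ 2))) with hk₁
  set k₂ : ℝ → ℝ := fun s => s ^ (-(1 : ℝ) / 2) * (w s * -(1 / (8 * (1 - s / 2) ^ 3))) with hk₂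
  have hτ : ∀ s ∈ Set.Icc (0 : ℝ) 1, 0 < 1 - s / 2 := fun s hs => by linarith [hs.2]
  have hτ' : ∀ s ∈ Set.Ioo (0 : ℝ) 1, 0 < 1 - s / 2 := fun s hs => by linarith [hs.2]
  have hbm : Measurable b := by fun_prop
  have hbc : ∀ s ∈ Set.Ioo (0 : ℝ) 1, 1 / 4 ≤ b s := fun s hs => by
    have := hτ' s hs
    simp only [hb, le_add_iff_nonneg_right]
    positivity
  have hwc : ContinuousOn w (Set.Icc 0 1) := by
    refine continuousOn_const.mul (continuousOn_const.mul ?_)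
    exact ContinuousOn.rpow_const (by fun_prop) fun s hs => Or.inl (hτ s hs).ne'
  have hk₁i : IntegrableOn k₁ (Set.Ioo 0 1) := by
    refine intervalIntegrable_rpow_mul (hwc.mul (ContinuousOn.div (by fun_prop) (by fun_prop) ?_))
    intro s hs
    have := hτ s hs
    positivity
  have hk₂i : IntegrableOn k₂ (Set.Ioo 0 1) := by
    refine intervalIntegrable_rpow_mul
      (hwc.mul (ContinuousOn.div (by fun_prop) (by fun_prop) ?_).neg)
    intro s hs
    have := hτ s hs
    positivity
  have hI₁ := integrable_prod_eval_mul_exp measurableSet_Ioo hk₁i hbm (by norm_num) hbc Q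
  have hI₂ := integrable_prod_eval_mul_exp measurableSet_Ioo hk₂i hbm (by norm_num) hbc
    (normSqPoly * Q)
  have hI : Integrable (Function.uncurry fun (y : EuclideanSpace ℝ (Fin 3)) s =>
      k₂ s * (eval y.ofLp (normSqPoly * Q) * rexp (-b s * ‖y‖ ^ 2)) +
        k₁ s * (eval y.ofLp Q * rexp (-b s * ‖y‖ ^ 2)))
      (volume.prod (volume.restrict (Set.Ioo 0 1))) := hI₂.add hI₁
  have hI' := hI.integral_prod_left
  simp only [Function.uncurry_apply_pair] at hI'
  have hint : ∀ y : EuclideanSpace ℝ (Fin 3), eval y.ofLp P * heatG 3 1 y *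
        (2 * dirD a (heatG 3 (1 / 2)) y + ∫ s in Set.Ioo (0 : ℝ) 1, s ^ (-(1 : ℝ) / 2) *
          lap (dirD a (heatG 3 (1 - s / 2))) y) =
      -2 * (A * (A * (1 / 2) ^ (-(3 : ℝ) / 2))) *
          (eval y.ofLp Q * rexp (-(1 / 4 + 1 / (4 * (1 / 2))) * ‖y‖ ^ 2)) +
        ∫ s in Set.Ioo (0 : ℝ) 1,
          (k₂ s * (eval y.ofLp (normSqPoly * Q) * rexp (-b s * ‖y‖ ^ 2)) +
          k₁ s * (eval y.ofLp Q * rexp (-b s * ‖y‖ ^ 2))) := by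
    intro y
    rw [mul_add, ← integral_const_mul]
    congr 1
    · have h := heatG_one_mul_heatG (t := 1 / 2) (by norm_num) y
      simp only [dirD_heatG, eval_heatDir_one, hQ, map_mul, hA]
      linear_combination (-2 * eval y.ofLp P * eval y.ofLp (linPoly a)) * h
    · refine setIntegral_congr_fun measurableSet_Ioo fun s hs => ?_
      have h := heatG_one_mul_heatG (hτ' s hs) y
      simp only [dirD_heatG, lap_eval_mul_heatG, eval_sum_heatOp_heatDir_one (hτ' s hs).ne']
      simp only [hk₁, hk₂, hw, hb, hQ, map_mul, hA]
      linear_combination (eval y.ofLp P * s ^ (-(1 : ℝ) / 2) * (-(1 / (8 * (1 - s / 2) ^ 3)) *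
        (eval y.ofLp normSqPoly * eval y.ofLp (linPoly a)) +
        5 / (4 * (1 - s / 2) ^ 2) * eval y.ofLp (linPoly a))) * h
  simp only [hint]
  rw [integral_add ((integrable_eval_mul_exp (by norm_num) Q).const_mul _) hI',
    integral_integral_swap hI, mul_add]
  congr 1
  · rw [integral_const_mul]
    change _ * gaussInt _ Q = _
    rw [hμ _ (by norm_num)]
    have h := heat_const_mul (t := 1 / 2) (by norm_num)
    rw [show (1 / (1 + 1 / 2) : ℝ) = 2 / 3 by norm_num] at h
    rw [← h, hA, show (1 / (2 * (1 / 4 + 1 / (4 * (1 / 2)))) : ℝ) = 2 / 3 by norm_num]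
    ring
  · rw [← integral_const_mul]
    refine setIntegral_congr_fun measurableSet_Ioo fun s hs => ?_
    have hs' := hτ' s hs
    have hb0 : 0 < b s := by linarith [hbc s hs]
    simp only
    rw [integral_add ((integrable_eval_mul_exp hb0 _).const_mul _)
      ((integrable_eval_mul_exp hb0 _).const_mul _), integral_const_mul, integral_const_mul]
    change k₂ s * gaussInt (b s) _ + k₁ s * gaussInt (b s) _ = _
    rw [gaussInt_normSqPoly_mul hb0 hQh, hμ _ hb0, hd, momentWeight, ← heat_const_mul hs']
    have e : 1 / (2 * b s) = 2 * (1 - s / 2) / (1 + (1 - s / 2)) := by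
      simp only [hb]
      generalize 1 - s / 2 = t at hs'
      field_simp
      ring
    rw [show (((2 * q : ℕ) : ℝ) + 3) / (2 * b s) = (2 * q + 3) * (1 / (2 * b s)) by push_cast; ring,
      e]
    simp only [hk₁, hk₂, hw]
    ring

/-- The integral `∫₀¹ s^{-1/2} (2 - s/2)^{-m-3/2} ds`. -/
noncomputable def betaInt (m : ℕ) : ℝ :=
  ∫ s in Set.Ioo (0 : ℝ) 1,
    s ^ (-(1 : ℝ) / 2) * ((1 / (2 - s / 2)) ^ (3 / 2 : ℝ) * (1 / (2 - s / 2)) ^ m)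

theorem integrableOn_betaInt (m : ℕ) : IntegrableOn (fun s : ℝ =>
    s ^ (-(1 : ℝ) / 2) * ((1 / (2 - s / 2)) ^ (3 / 2 : ℝ) * (1 / (2 - s / 2)) ^ m))
    (Set.Ioo 0 1) := by
  have hc : ContinuousOn (fun s : ℝ => 1 / (2 - s / 2)) (Set.Icc 0 1) :=
    ContinuousOn.div (by fun_prop) (by fun_prop) fun s hs => by linarith [hs.2]
  exact intervalIntegrable_rpow_mul
    ((hc.rpow_const fun s _ => Or.inr (by norm_num)).mul (hc.pow m))

theorem integral_momentWeight_one :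
    ∫ s in Set.Ioo (0 : ℝ) 1, s ^ (-(1 : ℝ) / 2) * momentWeight 1 (1 - s / 2) =
      5 / 2 * betaInt 2 := by
  rw [betaInt, ← integral_const_mul]
  refine setIntegral_congr_fun measurableSet_Ioo fun s hs => ?_
  have h1 : 1 + (1 - s / 2) = 2 - s / 2 := by ring
  have h2 : 2 - s / 2 ≠ 0 := by linarith [hs.2]
  have h3 : 1 - s / 2 ≠ 0 := by linarith [hs.2]
  simp only [momentWeight, h1]
  generalize (1 / (2 - s / 2)) ^ (3 / 2 : ℝ) = c
  have e : 2 * (1 - s / 2) / (2 - s / 2) * (-(1 / (8 * (1 - s / 2) ^ 3)) *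
      (5 * (2 * (1 - s / 2) / (2 - s / 2))) + 5 / (4 * (1 - s / 2) ^ 2)) =
      5 / 2 * (1 / (2 - s / 2)) ^ 2 := by
    have h4 : 4 - s ≠ 0 := by linarith [hs.2]
    have h5 : 2 - s ≠ 0 := by linarith [hs.2]
    rw [show 1 - s / 2 = (2 - s) / 2 by ring, show 2 - s / 2 = (4 - s) / 2 by ring]
    field_simp
    ring
  push_cast
  linear_combination s ^ (-(1 : ℝ) / 2) * c * e

theorem integral_momentWeight_two :
    ∫ s in Set.Ioo (0 : ℝ) 1, s ^ (-(1 : ℝ) / 2) * momentWeight 2 (1 - s / 2) =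
      5 * betaInt 2 - 7 * betaInt 3 := by
  rw [betaInt, betaInt, ← integral_const_mul, ← integral_const_mul,
    ← integral_sub ((integrableOn_betaInt 2).const_mul 5) ((integrableOn_betaInt 3).const_mul 7)]
  refine setIntegral_congr_fun measurableSet_Ioo fun s hs => ?_
  have h1 : 1 + (1 - s / 2) = 2 - s / 2 := by ring
  simp only [momentWeight, h1]
  generalize (1 / (2 - s / 2)) ^ (3 / 2 : ℝ) = c
  have e : (2 * (1 - s / 2) / (2 - s / 2)) ^ 2 * (-(1 / (8 * (1 - s / 2) ^ 3)) *
      (7 * (2 * (1 - s / 2) / (2 - s / 2))) + 5 / (4 * (1 - s / 2) ^ 2)) =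
      5 * (1 / (2 - s / 2)) ^ 2 - 7 * (1 / (2 - s / 2)) ^ 3 := by
    have h4 : 4 - s ≠ 0 := by linarith [hs.2]
    have h5 : 2 - s ≠ 0 := by linarith [hs.2]
    rw [show 1 - s / 2 = (2 - s) / 2 by ring, show 2 - s / 2 = (4 - s) / 2 by ring]
    field_simp
    ring
  push_cast
  linear_combination s ^ (-(1 : ℝ) / 2) * c * e

theorem rpow_three_halves {x : ℝ} (hx : 0 < x) : x ^ (3 / 2 : ℝ) = x * √x := by
  rw [show (3 / 2 : ℝ) = 1 + 1 / 2 by norm_num, rpow_add hx, rpow_one, sqrt_eq_rpow]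

theorem rpow_neg_half {x : ℝ} (hx : 0 < x) : x ^ (-(1 : ℝ) / 2) = (√x)⁻¹ := by
  rw [neg_div, rpow_neg hx.le, sqrt_eq_rpow]

theorem betaInt_three : betaInt 3 = 166 / 945 * √(2 / 3) := by
  have hcont : ContinuousOn (fun s : ℝ => √(s / (2 - s / 2))) (Set.Icc 0 1) :=
    (ContinuousOn.div (by fun_prop) (by fun_prop) fun s hs => by linarith [hs.2]).sqrt
  have h := intervalIntegral.integral_eq_sub_of_hasDerivAt_of_le (a := 0) (b := 1)
    (f := fun s : ℝ => 1 / 8 * (√(s / (2 - s / 2)) + 1 / 2 * √(s / (2 - s / 2)) ^ 3 +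
      3 / 20 * √(s / (2 - s / 2)) ^ 5 + 1 / 56 * √(s / (2 - s / 2)) ^ 7))
    (f' := fun s : ℝ =>
      s ^ (-(1 : ℝ) / 2) * ((1 / (2 - s / 2)) ^ (3 / 2 : ℝ) * (1 / (2 - s / 2)) ^ 3))
    zero_le_one (by fun_prop) ?_
    ((intervalIntegrable_iff_integrableOn_Ioo_of_le zero_le_one).2 (integrableOn_betaInt 3))
  · rw [betaInt, ← integral_Ioc_eq_integral_Ioo, ← intervalIntegral.integral_of_le zero_le_one, h]
    have h2 : √(2 / 3 : ℝ) ^ 2 = 2 / 3 := sq_sqrt (by norm_num)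
    rw [show (1 / (2 - 1 / 2) : ℝ) = 2 / 3 by norm_num, show (0 / (2 - 0 / 2) : ℝ) = 0 by norm_num,
      sqrt_zero, show √(2 / 3 : ℝ) ^ 3 = √(2 / 3) ^ 2 * √(2 / 3) by ring,
      show √(2 / 3 : ℝ) ^ 5 = (√(2 / 3) ^ 2) ^ 2 * √(2 / 3) by ring,
      show √(2 / 3 : ℝ) ^ 7 = (√(2 / 3) ^ 2) ^ 3 * √(2 / 3) by ring, h2]
    ring
  · intro s hs
    have hs0 := hs.1
    have hr : 0 < 2 - s / 2 := by linarith [hs.2]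
    have hd : HasDerivAt (fun s : ℝ => s / (2 - s / 2)) (2 / (2 - s / 2) ^ 2) s := by
      have := (hasDerivAt_id s).div (((hasDerivAt_id s).div_const 2).const_sub 2) hr.ne'
      refine this.congr_deriv ?_
      simp
      field_simp
      ring
    have hq := hd.sqrt (by positivity)
    have hF := (((hq.add ((hq.pow 3).const_mul (1 / 2))).add ((hq.pow 5).const_mul (3 / 20))).add
      ((hq.pow 7).const_mul (1 / 56))).const_mul (1 / 8)
    refine hF.congr_deriv ?_
    rw [rpow_three_halves (by positivity), rpow_neg_half hs0, sqrt_div hs0.le, sqrt_div zero_le_one,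
      sqrt_one]
    have hx : s = √s ^ 2 := (sq_sqrt hs0.le).symm
    have hz : √(2 - s / 2) ^ 2 = 2 - s / 2 := sq_sqrt hr.le
    have hu : 0 < √s := sqrt_pos.2 hs0
    have hv : 0 < √(2 - s / 2) := sqrt_pos.2 hr
    have hs' : √s ^ 2 = 4 - 2 * √(2 - s / 2) ^ 2 := by rw [hz, ← hx]; ring
    generalize √(2 - s / 2) = v at *
    generalize √s = u at *
    rw [← hz]
    have e : 1 / 8 * (1 + 3 / 2 * (u / v) ^ 2 + 3 / 4 * (u / v) ^ 4 + 1 / 8 * (u / v) ^ 6) =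
        1 / v ^ 6 := by
      rw [show (u / v) ^ 4 = (u ^ 2) ^ 2 / v ^ 4 by ring,
        show (u / v) ^ 6 = (u ^ 2) ^ 3 / v ^ 6 by ring, div_pow, hs']
      field_simp
      ring
    have e2 : (2 / (v ^ 2) ^ 2 / (2 * (u / v))) = 1 / (u * v ^ 3) := by
      field_simp
    rw [e2]
    push_cast
    transitivity 1 / (u * v ^ 3) * (1 / v ^ 6)
    · rw [← e]; ring
    · field_simp

theorem prefactor_mul_moments :
    -(√(2 * π) / (16 * π ^ 2)) * ((4 * π) ^ (-(3 : ℝ) / 2) *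
      ((-2 * (2 / 3) ^ 1 * (2 / 3) ^ (3 / 2 : ℝ) + 5 / 2 * betaInt 2) -
        (-2 * (2 / 3) ^ 2 * (2 / 3) ^ (3 / 2 : ℝ) + (5 * betaInt 2 - 7 * betaInt 3)) / 2)) =
      -(√3 / (2 ^ 6 * 3 ^ 3 * 5 * π ^ 3)) := by
  have h4 : √(4 * π) = 2 * √π := by
    rw [sqrt_mul (by norm_num), show (4 : ℝ) = 2 ^ 2 by norm_num, sqrt_sq (by norm_num)]
  have hπ : √π ^ 2 = π := sq_sqrt pi_pos.le
  have hπ0 : 0 < √π := sqrt_pos.2 pi_pos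
  rw [betaInt_three, rpow_three_halves (by norm_num : (0 : ℝ) < 2 / 3), neg_div,
    rpow_neg (by positivity), rpow_three_halves (by positivity), h4, sqrt_mul (by norm_num),
    sqrt_div (by norm_num)]
  have h2 : √(2 : ℝ) ^ 2 = 2 := sq_sqrt (by norm_num)
  have h3 : √(3 : ℝ) ^ 2 = 3 := sq_sqrt (by norm_num)
  have h30 : 0 < √(3 : ℝ) := by positivity
  field_simp
  ring_nf
  simp only [h2, h3]
  ring

theorem integral_moment_eq (a : EuclideanSpace ℝ (Fin 3)) (l : ℕ) (β : Fin 3 → ℕ)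
    {P : MvPolynomial (Fin 3) ℝ} (hβ : ∏ j, (X j : MvPolynomial (Fin 3) ℝ) ^ β j = P)
    {q : ℕ} (hq : ∑ j, β j + 1 = 2 * q) {μ : ℝ}
    (hμ : ∀ b : ℝ, 0 < b →
      gaussInt b (P * linPoly a) = μ * (1 / (2 * b)) ^ q * (π / b) ^ (3 / 2 : ℝ)) :
    ∫ y : EuclideanSpace ℝ (Fin 3), ((-1 : ℝ) ^ l * ∏ j, (-(y j)) ^ β j) * heatG 3 1 y *
        (2 * dirD a (heatG 3 (1 / 2)) y + ∫ s in Set.Ioo (0 : ℝ) 1, s ^ (-(1 : ℝ) / 2) *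
          lap (dirD a (heatG 3 (1 - s / 2))) y) =
      (-1) ^ (l + ∑ j, β j) *
        (μ * (4 * π) ^ (-(3 : ℝ) / 2) * (-2 * (2 / 3) ^ q * (2 / 3) ^ (3 / 2 : ℝ) +
          ∫ s in Set.Ioo (0 : ℝ) 1, s ^ (-(1 : ℝ) / 2) * momentWeight q (1 - s / 2))) := by
  have hP : P.IsHomogeneous (∑ j, β j) := by
    rw [← hβ]
    exact IsHomogeneous.prod _ _ _ fun j _ => by simpa using (isHomogeneous_X ℝ j).pow (β j)
  rw [← integral_eval_mul_kernel a hP hq hμ, ← integral_const_mul]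
  congr 1
  ext y
  have h : ∏ j, (-(y j)) ^ β j = (-1) ^ (∑ j, β j) * eval y.ofLp P := by
    rw [← hβ, map_prod, ← Finset.prod_pow_eq_pow_sum, ← Finset.prod_mul_distrib]
    simp only [map_pow, eval_X, ← mul_pow, neg_one_mul]
  rw [h, pow_add]
  ring

theorem integral_moment_one (a : EuclideanSpace ℝ (Fin 3)) (β : Fin 3 → ℕ) (i : Fin 3)
    (hβ : ∏ j, (X j : MvPolynomial (Fin 3) ℝ) ^ β j = X i) (hq : ∑ j, β j = 1) :
    ∫ y : EuclideanSpace ℝ (Fin 3), ((-1 : ℝ) ^ 1 * ∏ j, (-(y j)) ^ β j) * heatG 3 1 y *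
        (2 * dirD a (heatG 3 (1 / 2)) y + ∫ s in Set.Ioo (0 : ℝ) 1, s ^ (-(1 : ℝ) / 2) *
          lap (dirD a (heatG 3 (1 - s / 2))) y) =
      a i * ((4 * π) ^ (-(3 : ℝ) / 2) *
        (-2 * (2 / 3) ^ 1 * (2 / 3) ^ (3 / 2 : ℝ) + 5 / 2 * betaInt 2)) := by
  rw [integral_moment_eq a 1 β hβ (q := 1) (by omega) fun b hb => gaussInt_X_mul_linPoly hb a i,
    integral_momentWeight_one, hq]
  ring

theorem integral_moment_three (a : EuclideanSpace ℝ (Fin 3)) (β : Fin 3 → ℕ) (i j k : Fin 3)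
    (hβ : ∏ j, (X j : MvPolynomial (Fin 3) ℝ) ^ β j = X i * X j * X k) (hq : ∑ j, β j = 3) :
    ∫ y : EuclideanSpace ℝ (Fin 3), ((-1 : ℝ) ^ 0 * ∏ j, (-(y j)) ^ β j) * heatG 3 1 y *
        (2 * dirD a (heatG 3 (1 / 2)) y + ∫ s in Set.Ioo (0 : ℝ) 1, s ^ (-(1 : ℝ) / 2) *
          lap (dirD a (heatG 3 (1 - s / 2))) y) =
      -((if i = j then a k else 0) + (if i = k then a j else 0) + (if j = k then a i else 0)) *
        ((4 * π) ^ (-(3 : ℝ) / 2) *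
        (-2 * (2 / 3) ^ 2 * (2 / 3) ^ (3 / 2 : ℝ) + (5 * betaInt 2 - 7 * betaInt 3))) := by
  rw [integral_moment_eq a 0 β hβ (q := 2) (by omega)
    fun b hb => gaussInt_X_mul_X_mul_X_mul_linPoly hb a i j k, integral_momentWeight_two, hq]
  ring

/-- Functions on `Fin 3` as iterated pairs. -/
def finThreeArrowEquiv (α : Type*) : (Fin 3 → α) ≃ α × α × α where
  toFun f := (f 0, f 1, f 2)
  invFun p := ![p.1, p.2.1, p.2.2]
  left_inv f := by ext j; fin_cases j <;> rfl
  right_inv _ := rfl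

theorem sum_parabolic_degree_three (F : ℕ → (Fin 3 → ℕ) → ℝ) :
    ∑ p ∈ Finset.univ.filter
      (fun p : Fin 2 × (Fin 3 → Fin 4) => 2 * (p.1 : ℕ) + ∑ j, (p.2 j : ℕ) = 3),
      F p.1 (fun j => (p.2 j : ℕ)) =
    F 1 ![1, 0, 0] + F 1 ![0, 1, 0] + F 1 ![0, 0, 1] + F 0 ![3, 0, 0] + F 0 ![0, 3, 0] +
      F 0 ![0, 0, 3] + F 0 ![2, 1, 0] + F 0 ![2, 0, 1] + F 0 ![1, 2, 0] + F 0 ![0, 2, 1] +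
      F 0 ![1, 0, 2] + F 0 ![0, 1, 2] + F 0 ![1, 1, 1] := by
  have h : ∀ (l : ℕ) (α : Fin 3 → Fin 4),
      F l (fun j => (α j : ℕ)) = F l ![(α 0 : ℕ), α 1, α 2] := fun l α => by
    congr 1; ext j; fin_cases j <;> rfl
  have hsymm : ∀ p, (finThreeArrowEquiv (Fin 4)).symm p = ![p.1, p.2.1, p.2.2] := fun _ => rfl
  rw [Finset.sum_filter, Fintype.sum_prod_type]
  simp only [h, Fin.sum_univ_three]
  simp only [Fin.sum_univ_two, ← (finThreeArrowEquiv (Fin 4)).symm.sum_comp,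
    Fintype.sum_prod_type, hsymm]
  simp [Fin.sum_univ_four]
  ring

theorem lap_dirD_dirD_heatG (t : ℝ) (a x : EuclideanSpace ℝ (Fin 3)) :
    lap (dirD a (dirD a (heatG 3 t))) x =
      ∑ k, a k * ∑ j, eval x.ofLp (heatOp t j (heatOp t j (heatOp t k (heatDir t a 1)))) *
        heatG 3 t x := by
  rw [dirD_heatG, dirD_eval_mul_heatG, lap_eval_mul_heatG]
  generalize heatDir t a 1 = B
  simp only [heatDir, map_sum, heatOp_C_mul, map_mul, eval_C, Finset.sum_mul, Finset.mul_sum]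
  rw [Finset.sum_comm]
  simp only [mul_assoc]

theorem sum_moments_eq {t : ℝ} (ht : 0 < t) (a x : EuclideanSpace ℝ (Fin 3))
    {I : ℕ → (Fin 3 → ℕ) → ℝ} {V W : ℝ}
    (h₁ : ∀ (β : Fin 3 → ℕ) (i : Fin 3),
      ∏ j, (X j : MvPolynomial (Fin 3) ℝ) ^ β j = X i → ∑ j, β j = 1 → I 1 β = a i * V)
    (h₃ : ∀ (β : Fin 3 → ℕ) (i j k : Fin 3),
      ∏ j, (X j : MvPolynomial (Fin 3) ℝ) ^ β j = X i * X j * X k → ∑ j, β j = 3 →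
      I 0 β = -((if i = j then a k else 0) + (if i = k then a j else 0) +
        (if j = k then a i else 0)) * W) :
    ∑ p ∈ Finset.univ.filter
        (fun p : Fin 2 × (Fin 3 → Fin 4) => 2 * (p.1 : ℕ) + ∑ j, (p.2 j : ℕ) = 3),
      (tD (p.1 : ℕ) (fun τ => mD (fun j => (p.2 j : ℕ)) (dirD a (heatG 3 τ))) t x /
          ∏ j, ((p.2 j : ℕ).factorial : ℝ)) * I p.1 (fun j => (p.2 j : ℕ)) =
      (V - W / 2) * lap (dirD a (dirD a (heatG 3 t))) x := by
  have hD : ∀ k, deriv (fun τ => eval x.ofLp (heatOp τ k (heatDir τ a 1)) * heatG 3 τ x) t = _ :=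
    fun k => deriv_pd_dirD_heatG ht a k x
  refine (sum_parabolic_degree_three fun l β =>
    (tD l (fun τ => mD β (dirD a (heatG 3 τ))) t x / ∏ j, ((β j).factorial : ℝ)) * I l β).trans ?_
  rw [lap_dirD_dirD_heatG]
  simp only [fun τ => dirD_heatG τ a, mD_eval_mul_heatG]
  rw [h₁ ![1, 0, 0] 0 (by simp [Fin.prod_univ_three]) (by simp [Fin.sum_univ_three]),
    h₁ ![0, 1, 0] 1 (by simp [Fin.prod_univ_three]) (by simp [Fin.sum_univ_three]),
    h₁ ![0, 0, 1] 2 (by simp [Fin.prod_univ_three]) (by simp [Fin.sum_univ_three]),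
    h₃ ![3, 0, 0] 0 0 0 (by simp [Fin.prod_univ_three]; ring) (by simp [Fin.sum_univ_three]),
    h₃ ![0, 3, 0] 1 1 1 (by simp [Fin.prod_univ_three]; ring) (by simp [Fin.sum_univ_three]),
    h₃ ![0, 0, 3] 2 2 2 (by simp [Fin.prod_univ_three]; ring) (by simp [Fin.sum_univ_three]),
    h₃ ![2, 1, 0] 0 0 1 (by simp [Fin.prod_univ_three]; ring) (by simp [Fin.sum_univ_three]),
    h₃ ![2, 0, 1] 0 0 2 (by simp [Fin.prod_univ_three]; ring) (by simp [Fin.sum_univ_three]),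
    h₃ ![1, 2, 0] 1 1 0 (by simp [Fin.prod_univ_three]; ring) (by simp [Fin.sum_univ_three]),
    h₃ ![0, 2, 1] 1 1 2 (by simp [Fin.prod_univ_three]; ring) (by simp [Fin.sum_univ_three]),
    h₃ ![1, 0, 2] 2 2 0 (by simp [Fin.prod_univ_three]; ring) (by simp [Fin.sum_univ_three]),
    h₃ ![0, 1, 2] 2 2 1 (by simp [Fin.prod_univ_three]; ring) (by simp [Fin.sum_univ_three]),
    h₃ ![1, 1, 1] 0 1 2 (by simp [Fin.prod_univ_three]) (by simp [Fin.sum_univ_three])]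
  clear h₁ h₃
  have tD0 : ∀ F : ℝ → EuclideanSpace ℝ (Fin 3) → ℝ, tD 0 F t x = F t x := fun _ => rfl
  have tD1 : ∀ F : ℝ → EuclideanSpace ℝ (Fin 3) → ℝ, tD 1 F t x = deriv (fun τ => F τ x) t :=
    fun _ => rfl
  have it0 : ∀ (f : MvPolynomial (Fin 3) ℝ → MvPolynomial (Fin 3) ℝ) P, f^[0] P = P :=
    fun _ _ => rfl
  have it1 : ∀ (f : MvPolynomial (Fin 3) ℝ → MvPolynomial (Fin 3) ℝ) P, f^[1] P = f P :=
    fun _ _ => rfl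
  have it2 : ∀ (f : MvPolynomial (Fin 3) ℝ → MvPolynomial (Fin 3) ℝ) P, f^[2] P = f (f P) :=
    fun _ _ => rfl
  have it3 : ∀ (f : MvPolynomial (Fin 3) ℝ → MvPolynomial (Fin 3) ℝ) P, f^[3] P = f (f (f P)) :=
    fun _ _ => rfl
  simp only [tD0, tD1, Fin.prod_univ_three, Matrix.cons_val, it0, it1, it2, it3]
  simp only [hD, Fin.sum_univ_three]
  simp [Nat.factorial]
  generalize heatDir t a 1 = B
  simp only [heatOp_comm t 1 0, heatOp_comm t 2 0, heatOp_comm t 2 1]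
  ring

/-- the logarithmic coefficient `K` equals
`−(√3/(2⁶·3³·5π³)) Δ(a·∇)²G(t)`. -/
theorem log_coefficient_identity (a : EuclideanSpace ℝ (Fin 3))
    (K : ℝ → EuclideanSpace ℝ (Fin 3) → ℝ)
    (hK : ∀ t x, K t x = -(Real.sqrt (2 * π) / (16 * π ^ 2)) *
      ∑ p ∈ Finset.univ.filter
          (fun p : Fin 2 × (Fin 3 → Fin 4) => 2 * (p.1 : ℕ) + ∑ j, (p.2 j : ℕ) = 3),
        (tD (p.1 : ℕ) (fun τ => mD (fun j => (p.2 j : ℕ)) (dirD a (heatG 3 τ))) t x /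
            ∏ j, ((p.2 j : ℕ).factorial : ℝ)) *
          ∫ y : EuclideanSpace ℝ (Fin 3),
            ((-1 : ℝ) ^ (p.1 : ℕ) * ∏ j, (-(y j)) ^ (p.2 j : ℕ)) * heatG 3 1 y *
              (2 * dirD a (heatG 3 (1 / 2)) y +
                ∫ s in Set.Ioo (0 : ℝ) 1, s ^ (-(1 : ℝ) / 2) *
                  lap (dirD a (heatG 3 (1 - s / 2))) y)) :
    ∀ t : ℝ, 0 < t → ∀ x, K t x =
      -(Real.sqrt 3 / (2 ^ 6 * 3 ^ 3 * 5 * π ^ 3)) *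
        lap (dirD a (dirD a (heatG 3 t))) x := by
  intro t ht x
  have h := sum_moments_eq ht a x (I := fun l β => ∫ y : EuclideanSpace ℝ (Fin 3),
    ((-1 : ℝ) ^ l * ∏ j, (-(y j)) ^ β j) * heatG 3 1 y *
      (2 * dirD a (heatG 3 (1 / 2)) y + ∫ s in Set.Ioo (0 : ℝ) 1, s ^ (-(1 : ℝ) / 2) *
        lap (dirD a (heatG 3 (1 - s / 2))) y))
    (integral_moment_one a) (integral_moment_three a)
  rw [hK, h, ← prefactor_mul_moments]
  ring
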